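/- For every positive integer m, ξ₂(m) = m + ξ(m), where ξ(m) := Σ_{k=0}^{m} C(m,k) (k/m)^k (1 − k/m)^{m−k} and ξ₂(m) := Σ_{j=0}^{m} Σ_{k=0}^{m−j} C(m,j) C(m−j,k) (j/m)^j (k/m)^k (1 − j/m − k/m)^{m−j−k} (with the convention 0^0 = 1). -/

import Mathlib

/-- Cauchy's convolution identity of Abel type, in the form
`∑ₖ C(n,k) kᵏ (s - k)ⁿ⁻ᵏ = ∑ᵢ n(n-1)⋯(n-i+1) sⁿ⁻ⁱ`. -/
theorem sum_choose_mul_pow_mul_sub_pow {R : Type*} [CommRing R] (n : ℕ) (s : R) :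
    ∑ k ∈ Finset.range (n + 1), (n.choose k : R) * (k : R) ^ k * (s - k) ^ (n - k) =
      ∑ i ∈ Finset.range (n + 1), (n.descFactorial i : R) * s ^ (n - i) := by
  have expand : ∀ k ∈ Finset.range (n + 1),
      (n.choose k : R) * (k : R) ^ k * (s - k) ^ (n - k) =
        ∑ i ∈ Finset.range (n + 1), (n.choose i : R) * s ^ (n - i) *
          (if k ≤ i then (-1) ^ (i - k) * (i.choose k : R) * (k : R) ^ i else 0) := by
    intro k hk
    have hk : k ≤ n := Nat.lt_succ_iff.mp (Finset.mem_range.mp hk)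
    simp_rw [mul_ite, mul_zero]
    rw [← Finset.sum_filter]
    have : (Finset.range (n + 1)).filter (fun i => k ≤ i) = Finset.Ico k (n + 1) := by
      ext i; simp; omega
    rw [this, Finset.sum_Ico_eq_sum_range, sub_eq_neg_add, add_pow, Finset.mul_sum,
      show n + 1 - k = n - k + 1 by omega]
    refine Finset.sum_congr rfl fun l hl => ?_
    have hl : l ≤ n - k := Nat.lt_succ_iff.mp (Finset.mem_range.mp hl)
    have hc : (n.choose (k + l) : R) * ((k + l).choose k : R) =
        (n.choose k : R) * ((n - k).choose l : R) := by
      have := Nat.choose_mul (n := n) (k := k + l) (s := k) (by omega)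
      rw [Nat.add_sub_cancel_left] at this
      rw [← Nat.cast_mul, this, Nat.cast_mul]
    rw [Nat.add_sub_cancel_left, neg_pow, pow_add, show n - (k + l) = n - k - l by omega]
    linear_combination (-(s ^ (n - k - l) * (-1) ^ l * (k : R) ^ k * (k : R) ^ l)) * hc
  rw [Finset.sum_congr rfl expand, Finset.sum_comm]
  refine Finset.sum_congr rfl fun i hi => ?_
  have hi : i ≤ n := Nat.lt_succ_iff.mp (Finset.mem_range.mp hi)
  have hdiff := congrFun (fwdDiff_iter_eq_factorial (R := R) (n := i)) 0
  rw [fwdDiff_iter_eq_sum_shift] at hdiff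
  have hsum : ∑ k ∈ Finset.range (n + 1),
      (if k ≤ i then (-1) ^ (i - k) * (i.choose k : R) * (k : R) ^ i else 0) =
        (i.factorial : R) := by
    rw [← Finset.sum_filter]
    have : (Finset.range (n + 1)).filter (fun k => k ≤ i) = Finset.range (i + 1) := by
      ext k; simp; omega
    rw [this]
    simpa [zsmul_eq_mul] using hdiff
  rw [← Finset.mul_sum, hsum, Nat.descFactorial_eq_factorial_mul_choose]
  push_cast
  ring

theorem sum_range_sum_range_add {M : Type*} [CommSemiring M] (m : ℕ) (g : ℕ → M) :
    ∑ i ∈ Finset.range (m + 1), ∑ l ∈ Finset.range (m - i + 1), g (i + l) =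
      ∑ k ∈ Finset.range (m + 1), ((k : M) + 1) * g k := by
  have h : ∀ i ∈ Finset.range (m + 1), ∑ l ∈ Finset.range (m - i + 1), g (i + l) =
      ∑ k ∈ Finset.Ico i (m + 1), g k := by
    intro i hi
    have := Finset.mem_range.mp hi
    rw [Finset.sum_Ico_eq_sum_range, show m + 1 - i = m - i + 1 by omega]
  rw [Finset.sum_congr rfl h, Finset.sum_comm' (t' := Finset.range (m + 1))
    (s' := fun k => Finset.range (k + 1)) (by intro x y; simp; omega)]
  simp

/-- The trinomial analogue of Cauchy's identity at the diagonal point. -/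
theorem sum_sum_choose_mul_pow_self {R : Type*} [CommRing R] (m : ℕ) :
    ∑ j ∈ Finset.range (m + 1), ∑ k ∈ Finset.range (m - j + 1),
      (m.choose j : R) * ((m - j).choose k : R) * (j : R) ^ j * (k : R) ^ k *
        ((m : R) - j - k) ^ (m - j - k) =
      ∑ k ∈ Finset.range (m + 1), ((k : R) + 1) * ((m.descFactorial k : R) * (m : R) ^ (m - k)) := by
  have inner : ∀ j ∈ Finset.range (m + 1), ∑ k ∈ Finset.range (m - j + 1),
      (m.choose j : R) * ((m - j).choose k : R) * (j : R) ^ j * (k : R) ^ k *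
        ((m : R) - j - k) ^ (m - j - k) =
      ∑ i ∈ Finset.range (m - j + 1), (m.choose j : R) * (j : R) ^ j *
        (((m - j).descFactorial i : R) * ((m : R) - j) ^ (m - j - i)) := by
    intro j _
    rw [← Finset.mul_sum, ← sum_choose_mul_pow_mul_sub_pow, Finset.mul_sum]
    exact Finset.sum_congr rfl fun k _ => by ring
  rw [Finset.sum_congr rfl inner, Finset.sum_comm' (t' := Finset.range (m + 1))
    (s' := fun i => Finset.range (m - i + 1)) (by intro x y; simp; omega),
    ← sum_range_sum_range_add m fun k => (m.descFactorial k : R) * (m : R) ^ (m - k)]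
  refine Finset.sum_congr rfl fun i hi => ?_
  have hi : i ≤ m := Nat.lt_succ_iff.mp (Finset.mem_range.mp hi)
  have hdesc : ∀ l, (m.descFactorial (i + l) : R) =
      (m.descFactorial i : R) * ((m - i).descFactorial l : R) := by
    intro l
    have := Nat.descFactorial_mul_descFactorial (n := m) (k := i) (m := i + l) (by omega)
    rw [Nat.add_sub_cancel_left] at this
    rw [← this]; push_cast; ring
  simp_rw [hdesc, mul_assoc, ← Nat.sub_sub]
  rw [← Finset.mul_sum, ← sum_choose_mul_pow_mul_sub_pow, Finset.mul_sum]
  refine Finset.sum_congr rfl fun j hj => ?_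
  have hj : j ≤ m - i := Nat.lt_succ_iff.mp (Finset.mem_range.mp hj)
  have hc : (m.choose j : R) * ((m - j).descFactorial i : R) =
      (m.descFactorial i : R) * ((m - i).choose j : R) := by
    rw [Nat.descFactorial_eq_factorial_mul_choose, Nat.descFactorial_eq_factorial_mul_choose]
    have h1 := Nat.choose_mul (n := m) (k := i + j) (s := i) (by omega)
    have h2 := Nat.choose_mul (n := m) (k := i + j) (s := j) (by omega)
    rw [Nat.add_sub_cancel_left] at h1
    rw [Nat.add_sub_cancel, ← Nat.choose_symm_add, h1] at h2
    have h2 : (m.choose i : R) * ((m - i).choose j : R) =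
        (m.choose j : R) * ((m - j).choose i : R) := by
      rw [← Nat.cast_mul, h2, Nat.cast_mul]
    push_cast
    linear_combination (-(i.factorial : R)) * h2
  rw [show m - j - i = m - i - j by omega]
  linear_combination ((j : R) ^ j * ((m : R) - j) ^ (m - i - j)) * hc

theorem sum_mul_descFactorial_mul_pow {R : Type*} [CommRing R] (m : ℕ) :
    ∑ k ∈ Finset.range (m + 1), (k : R) * ((m.descFactorial k : R) * (m : R) ^ (m - k)) =
      (m : R) * (m : R) ^ m := by
  have step : ∀ k ∈ Finset.range (m + 1),
      (k : R) * ((m.descFactorial k : R) * (m : R) ^ (m - k)) =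
        (m.descFactorial k : R) * (m : R) ^ (m + 1 - k) -
          (m.descFactorial (k + 1) : R) * (m : R) ^ (m + 1 - (k + 1)) := by
    intro k hk
    have hk : k ≤ m := Nat.lt_succ_iff.mp (Finset.mem_range.mp hk)
    rw [Nat.descFactorial_succ, Nat.cast_mul, Nat.cast_sub hk,
      show m + 1 - k = m - k + 1 by omega, Nat.add_sub_add_right, pow_succ]
    ring
  rw [Finset.sum_congr rfl step, Finset.sum_range_sub']
  simp [pow_succ']

/-- Lacasse's conjecture: for every positive integer `m`, `ξ₂(m) = m + ξ(m)`. -/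
theorem lacasse_conjecture (m : ℕ) (hm : 0 < m) :
    (∑ j ∈ Finset.range (m + 1), ∑ k ∈ Finset.range (m - j + 1),
      (m.choose j : ℝ) * ((m - j).choose k : ℝ) * ((j : ℝ) / m) ^ j * ((k : ℝ) / m) ^ k *
        (1 - (j : ℝ) / m - (k : ℝ) / m) ^ (m - j - k)) =
    (m : ℝ) + ∑ k ∈ Finset.range (m + 1),
      (m.choose k : ℝ) * ((k : ℝ) / m) ^ k * (1 - (k : ℝ) / m) ^ (m - k) := by
  have hm0 : (m : ℝ) ≠ 0 := by positivity
  refine mul_right_cancel₀ (pow_ne_zero m hm0) ?_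
  have hleft : (∑ j ∈ Finset.range (m + 1), ∑ k ∈ Finset.range (m - j + 1),
      (m.choose j : ℝ) * ((m - j).choose k : ℝ) * ((j : ℝ) / m) ^ j * ((k : ℝ) / m) ^ k *
        (1 - (j : ℝ) / m - (k : ℝ) / m) ^ (m - j - k)) * (m : ℝ) ^ m =
      ∑ j ∈ Finset.range (m + 1), ∑ k ∈ Finset.range (m - j + 1),
        (m.choose j : ℝ) * ((m - j).choose k : ℝ) * (j : ℝ) ^ j * (k : ℝ) ^ k *
          ((m : ℝ) - j - k) ^ (m - j - k) := by
    simp_rw [Finset.sum_mul]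
    refine Finset.sum_congr rfl fun j hj => Finset.sum_congr rfl fun k hk => ?_
    rw [Finset.mem_range] at hj hk
    have hpow : (m : ℝ) ^ m = (m : ℝ) ^ j * (m : ℝ) ^ k * (m : ℝ) ^ (m - j - k) := by
      rw [← pow_add, ← pow_add]; congr 1; omega
    rw [hpow, show (1 : ℝ) - j / m - k / m = (m - j - k) / m by field_simp,
      div_pow, div_pow, div_pow]
    field_simp
  have hright : (∑ k ∈ Finset.range (m + 1),
      (m.choose k : ℝ) * ((k : ℝ) / m) ^ k * (1 - (k : ℝ) / m) ^ (m - k)) * (m : ℝ) ^ m =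
      ∑ k ∈ Finset.range (m + 1),
        (m.choose k : ℝ) * (k : ℝ) ^ k * ((m : ℝ) - k) ^ (m - k) := by
    rw [Finset.sum_mul]
    refine Finset.sum_congr rfl fun k hk => ?_
    rw [Finset.mem_range] at hk
    have hpow : (m : ℝ) ^ m = (m : ℝ) ^ k * (m : ℝ) ^ (m - k) := by
      rw [← pow_add]; congr 1; omega
    rw [hpow, show (1 : ℝ) - k / m = (m - k) / m by field_simp, div_pow, div_pow]
    field_simp
  rw [add_mul, hleft, hright, sum_sum_choose_mul_pow_self, sum_choose_mul_pow_mul_sub_pow,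
    ← sum_mul_descFactorial_mul_pow, ← Finset.sum_add_distrib]
  exact Finset.sum_congr rfl fun k _ => by ring
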